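/- Let P = {X_i : i ∈ I} be a partition of a set X. The quotient semigroup Σ(X,P)/χ is isomorphic to the semigroup of all surjective selfmaps of the index set I. -/

import Mathlib

/-- `B : I → Set X` is a partition of `X`: blocks are nonempty, pairwise disjoint, and cover. -/
def IsPartition {X I : Type*} (B : I → Set X) : Prop :=
  (∀ i, (B i).Nonempty) ∧ (Pairwise fun i j => Disjoint (B i) (B j)) ∧ ∀ x, ∃ i, x ∈ B i

/-- `f ∈ T(X,P)`: every block maps into some block. -/
def InT {X I : Type*} (B : I → Set X) (f : X → X) : Prop := ∀ i, ∃ j, f '' B i ⊆ B j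

/-- `c` is the character `χ^(f)` of `f`: `f(X_i) ⊆ X_{c i}` for every `i`. -/
def IsChar {X I : Type*} (B : I → Set X) (f : X → X) (c : I → I) : Prop :=
  ∀ i, f '' B i ⊆ B (c i)

/-- `f ∈ Σ(X,P)`: `f ∈ T(X,P)` and the image of `f` meets every block. -/
def InSigma {X I : Type*} (B : I → Set X) (f : X → X) : Prop :=
  InT B f ∧ ∀ i, (Set.range f ∩ B i).Nonempty

/-- `f ∈ S(X,P)`, the group of units of `T(X,P)`: `f` is a bijection and
both `f` and its inverse belong to `T(X,P)`. -/
def InS {X I : Type*} (B : I → Set X) (f : X → X) : Prop :=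
  ∃ g : X → X, Function.LeftInverse g f ∧ Function.RightInverse g f ∧ InT B f ∧ InT B g

/-- The congruence `χ` (equality of characters) on `Σ(X,P)`. -/
def sigmaSetoid {X I : Type*} (B : I → Set X) : Setoid {f : X → X // InSigma B f} :=
  ⟨fun f g => ∀ c : I → I, IsChar B f.1 c ↔ IsChar B g.1 c,
    fun _ _ => Iff.rfl,
    fun h c => (h c).symm,
    fun h₁ h₂ c => (h₁ c).trans (h₂ c)⟩

namespace IsPartition

variable {X I : Type*} {B : I → Set X}

theorem eq_of_mem (hP : IsPartition B) {x : X} {i j : I} (hi : x ∈ B i) (hj : x ∈ B j) :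
    i = j := by
  by_contra h
  exact Set.disjoint_left.mp (hP.2.1 h) hi hj

/-- The character of a map is unique. -/
theorem isChar_unique (hP : IsPartition B) {f : X → X} {c d : I → I} (hc : IsChar B f c)
    (hd : IsChar B f d) : c = d := by
  funext i
  obtain ⟨x, hx⟩ := hP.1 i
  exact hP.eq_of_mem (hc i ⟨x, hx, rfl⟩) (hd i ⟨x, hx, rfl⟩)

theorem isChar_surjective (hP : IsPartition B) {f : X → X} (hf : InSigma B f) {c : I → I}
    (hc : IsChar B f c) : Function.Surjective c := by
  intro j
  obtain ⟨_, ⟨x, rfl⟩, hj⟩ := hf.2 j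
  obtain ⟨i, hi⟩ := hP.2.2 x
  exact ⟨i, hP.eq_of_mem (hc i ⟨x, hi, rfl⟩) hj⟩

/-- Every surjective selfmap of the index set is the character of some element of `Σ(X,P)`. -/
theorem exists_inSigma_isChar (hP : IsPartition B) {c : I → I} (hc : Function.Surjective c) :
    ∃ f, InSigma B f ∧ IsChar B f c := by
  choose p hp using hP.1
  choose idx hidx using hP.2.2
  have hchar : IsChar B (fun x => p (c (idx x))) c := by
    rintro i _ ⟨x, hx, rfl⟩
    rw [← hP.eq_of_mem (hidx x) hx]
    exact hp _
  refine ⟨_, ⟨fun i => ⟨c i, hchar i⟩, fun j => ?_⟩, hchar⟩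
  obtain ⟨i, rfl⟩ := hc j
  exact ⟨_, ⟨p i, rfl⟩, hchar i ⟨p i, hp i, rfl⟩⟩

end IsPartition

theorem IsChar.comp {X I : Type*} {B : I → Set X} {f g : X → X} {c d : I → I}
    (hg : IsChar B g d) (hf : IsChar B f c) : IsChar B (g ∘ f) (d ∘ c) := by
  rintro i _ ⟨x, hx, rfl⟩
  exact hg (c i) ⟨f x, hf i ⟨x, hx, rfl⟩, rfl⟩

theorem stmt6 {X I : Type*} (B : I → Set X) (hP : IsPartition B) :
    ∃ e : Quotient (sigmaSetoid B) ≃ {φ : I → I // Function.Surjective φ},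
      ∀ f g h : {f : X → X // InSigma B f}, h.1 = g.1 ∘ f.1 →
        (e (Quotient.mk (sigmaSetoid B) h)).1 =
          (e (Quotient.mk (sigmaSetoid B) g)).1 ∘ (e (Quotient.mk (sigmaSetoid B) f)).1 := by
  have hex (f : {f : X → X // InSigma B f}) : ∃ c, IsChar B f.1 c := Classical.skolem.mp f.2.1
  choose χ hχ using hex
  have hmk (f g : {f : X → X // InSigma B f}) (h : sigmaSetoid B f g) : χ f = χ g :=
    hP.isChar_unique ((h _).mp (hχ f)) (hχ g)
  let F : Quotient (sigmaSetoid B) → {φ : I → I // Function.Surjective φ} :=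
    Quotient.lift (fun f => ⟨χ f, hP.isChar_surjective f.2 (hχ f)⟩)
      fun f g h => Subtype.ext (hmk f g h)
  have hF : Function.Bijective F := by
    constructor
    · rintro ⟨f⟩ ⟨g⟩ h
      have hfg : χ f = χ g := congrArg Subtype.val h
      refine Quotient.sound fun c => ⟨fun hc => ?_, fun hc => ?_⟩
      · rw [hP.isChar_unique hc (hχ f), hfg]
        exact hχ g
      · rw [hP.isChar_unique hc (hχ g), ← hfg]
        exact hχ f
    · rintro ⟨c, hc⟩
      obtain ⟨f, hf, hfc⟩ := hP.exists_inSigma_isChar hc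
      exact ⟨Quotient.mk _ ⟨f, hf⟩, Subtype.ext (hP.isChar_unique (hχ ⟨f, hf⟩) hfc)⟩
  refine ⟨Equiv.ofBijective F hF, fun f g h hfg => ?_⟩
  change χ h = χ g ∘ χ f
  exact hP.isChar_unique (hχ h) (hfg ▸ (hχ g).comp (hχ f))
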